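/- In the noisy matrix-sensing setting with b = 𝒜(M+N), let the alternating-minimization update be V̂^{t+1} = V*Σ*(U*)ᵀU^t − F + V^N Σ^N (U^N)ᵀ U^t − G = V^{t+1}R^{(t+1)} (QR decomposition), where M = U*Σ*(V*)ᵀ is rank-k with singular values σ*_1 ≥ ... ≥ σ*_k, N = U^NΣ^N(V^N)ᵀ with top noise singular value σ^N_1, and F, G are the respective error matrices. Then σ_min(R^{(t+1)}) ≥ σ*_k √(1 − dist(U^t, U*)²) − σ^N_1 − ‖F‖₂ − ‖G‖₂. -/

import Mathlib

open Matrix MeasureTheory Finset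

noncomputable section

namespace AltMin

/-- Euclidean norm of a finitely-indexed real vector. -/
def euclNorm {ι : Type*} [Fintype ι] (v : ι → ℝ) : ℝ :=
  Real.sqrt (∑ i, v i ^ 2)

/-- Frobenius norm of a real matrix. -/
def frobNorm {ι κ : Type*} [Fintype ι] [Fintype κ] (A : Matrix ι κ ℝ) : ℝ :=
  Real.sqrt (∑ i, ∑ j, A i j ^ 2)

/-- Spectral norm of a real matrix. -/
def specNorm {ι κ : Type*} [Fintype ι] [Fintype κ] (A : Matrix ι κ ℝ) : ℝ :=
  sSup {r : ℝ | ∃ v : κ → ℝ, euclNorm v = 1 ∧ r = euclNorm (A.mulVec v)}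

/-- Minimum singular value of a square real matrix. -/
def minSingVal {ι : Type*} [Fintype ι] (A : Matrix ι ι ℝ) : ℝ :=
  sInf {r : ℝ | ∃ v : ι → ℝ, euclNorm v = 1 ∧ r = euclNorm (A.mulVec v)}

/-- Orthogonal projection onto the column span of a (full column rank) matrix. -/
def colProj {m k : ℕ} (W : Matrix (Fin m) (Fin k) ℝ) : Matrix (Fin m) (Fin m) ℝ :=
  W * (Wᵀ * W)⁻¹ * Wᵀ

/-- Principal-angle distance `dist(W₁, W₂) = ‖(W₁⊥)ᵀ W₂‖₂` between column spans,
expressed basis-independently via orthogonal projections. -/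
def matDist {m k₁ k₂ : ℕ} (W₁ : Matrix (Fin m) (Fin k₁) ℝ)
    (W₂ : Matrix (Fin m) (Fin k₂) ℝ) : ℝ :=
  specNorm ((1 - colProj W₁) * colProj W₂)

/-- The linear measurement operator `𝒜(X)ᵢ = tr(Aᵢᵀ X)`. -/
def sense {m n d : ℕ} (A : Fin d → Matrix (Fin m) (Fin n) ℝ)
    (X : Matrix (Fin m) (Fin n) ℝ) : Fin d → ℝ :=
  fun i => ((A i)ᵀ * X).trace

/-- The adjoint `𝒜ᵀ(y) = ∑ i, yᵢ Aᵢ` of the measurement operator. -/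
def senseAdj {m n d : ℕ} (A : Fin d → Matrix (Fin m) (Fin n) ℝ) (y : Fin d → ℝ) :
    Matrix (Fin m) (Fin n) ℝ :=
  ∑ i, y i • A i

/-- `k`-restricted isometry property with constant `δ`. -/
def RIP {m n d : ℕ} (A : Fin d → Matrix (Fin m) (Fin n) ℝ) (k : ℕ) (δ : ℝ) : Prop :=
  ∀ X : Matrix (Fin m) (Fin n) ℝ, X.rank ≤ k →
    (1 - δ) * frobNorm X ^ 2 ≤ euclNorm (sense A X) ^ 2 ∧
      euclNorm (sense A X) ^ 2 ≤ (1 + δ) * frobNorm X ^ 2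

/-- `U` consists of top-`k` left singular vectors of `Y`:  `U` has orthonormal columns and
maximizes `‖U'ᵀ Y‖_F` over all matrices with orthonormal columns. -/
def IsTopKLeftSing {m n k : ℕ} (Y : Matrix (Fin m) (Fin n) ℝ)
    (U : Matrix (Fin m) (Fin k) ℝ) : Prop :=
  Uᵀ * U = 1 ∧ ∀ U' : Matrix (Fin m) (Fin k) ℝ, U'ᵀ * U' = 1 →
    frobNorm (U'ᵀ * Y) ≤ frobNorm (Uᵀ * Y)

/-- `Z` is a best rank-`i` approximation of `Y` in Frobenius norm
(the top-`i` singular components of `Y`). -/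
def IsBestRankApprox {m n : ℕ} (Y Z : Matrix (Fin m) (Fin n) ℝ) (i : ℕ) : Prop :=
  Z.rank ≤ i ∧ ∀ W : Matrix (Fin m) (Fin n) ℝ, W.rank ≤ i →
    frobNorm (Y - Z) ≤ frobNorm (Y - W)

/-- `P_Ω`: keep the entries in `Ω`, zero out the rest. -/
def projO {m n : ℕ} (Ω : Set (Fin m × Fin n)) (X : Matrix (Fin m) (Fin n) ℝ) :
    Matrix (Fin m) (Fin n) ℝ :=
  fun i j => Set.indicator Ω (fun _ => X i j) (i, j)

/-- Clip to zero all entries of magnitude greater than `θ`. -/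
def clip {m k : ℕ} (θ : ℝ) (W : Matrix (Fin m) (Fin k) ℝ) : Matrix (Fin m) (Fin k) ℝ :=
  fun i j => if θ < |W i j| then 0 else W i j

/-- Bernoulli measure with parameter `p` on `Bool`. -/
def bernoulliMeasure (p : ℝ) : Measure Bool :=
  ENNReal.ofReal p • Measure.dirac true + ENNReal.ofReal (1 - p) • Measure.dirac false

/-- Each entry of an `m × n` matrix is observed independently with probability `p`. -/
def sampleMeasure (m n : ℕ) (p : ℝ) : Measure ((Fin m × Fin n) → Bool) :=
  Measure.pi fun _ => bernoulliMeasure p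

instance optionMeasurableSpace {α : Type*} : MeasurableSpace (Option α) := ⊤

/-- Each entry is (independently) unobserved with probability `1 - p`, and observed and
assigned to one of `K` buckets uniformly otherwise. -/
def partMeasure (K : ℕ) (p : ℝ) : Measure (Option (Fin K)) :=
  ENNReal.ofReal (1 - p) • Measure.dirac none +
    ∑ t : Fin K, ENNReal.ofReal (p / K) • Measure.dirac (some t)

/-- Product sampling measure for the partitioned-observation model. -/
def partSampleMeasure (m n K : ℕ) (p : ℝ) : Measure ((Fin m × Fin n) → Option (Fin K)) :=
  Measure.pi fun _ => partMeasure K p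

/-- The `j`-th bucket of observed entries. -/
def partSet {m n K : ℕ} (ω : Fin m × Fin n → Option (Fin K)) (j : ℕ) :
    Set (Fin m × Fin n) :=
  {q | Option.map Fin.val (ω q) = some j}

end AltMin

namespace AltMin

theorem euclNorm_nonneg {ι : Type*} [Fintype ι] (v : ι → ℝ) : 0 ≤ euclNorm v :=
  Real.sqrt_nonneg _

theorem euclNorm_sq {ι : Type*} [Fintype ι] (v : ι → ℝ) : euclNorm v ^ 2 = v ⬝ᵥ v := by
  rw [euclNorm, Real.sq_sqrt (Finset.sum_nonneg fun i _ => sq_nonneg _)]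
  simp [dotProduct, sq]

theorem euclNorm_eq_norm {ι : Type*} [Fintype ι] (v : ι → ℝ) :
    euclNorm v = ‖WithLp.toLp 2 v‖ := by
  simp [euclNorm, EuclideanSpace.norm_eq]

theorem euclNorm_add_le {ι : Type*} [Fintype ι] (v w : ι → ℝ) :
    euclNorm (v + w) ≤ euclNorm v + euclNorm w := by
  simpa [euclNorm_eq_norm] using norm_add_le (WithLp.toLp 2 v) (WithLp.toLp 2 w)

theorem euclNorm_le_mul_of_abs_le {ι : Type*} [Fintype ι] {v w : ι → ℝ} {c : ℝ} (hc : 0 ≤ c)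
    (h : ∀ i, |v i| ≤ c * |w i|) : euclNorm v ≤ c * euclNorm w := by
  rw [euclNorm, euclNorm, ← Real.sqrt_sq hc, ← Real.sqrt_mul (sq_nonneg c), Finset.mul_sum]
  refine Real.sqrt_le_sqrt (Finset.sum_le_sum fun i _ => ?_)
  rw [← mul_pow, ← sq_abs (v i), ← sq_abs (c * w i), abs_mul, abs_of_nonneg hc]
  exact pow_le_pow_left₀ (abs_nonneg _) (h i) 2

theorem mul_euclNorm_le_of_le_abs {ι : Type*} [Fintype ι] {v w : ι → ℝ} {c : ℝ} (hc : 0 ≤ c)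
    (h : ∀ i, c * |w i| ≤ |v i|) : c * euclNorm w ≤ euclNorm v := by
  rw [euclNorm, euclNorm, ← Real.sqrt_sq hc, ← Real.sqrt_mul (sq_nonneg c), Finset.mul_sum]
  refine Real.sqrt_le_sqrt (Finset.sum_le_sum fun i _ => ?_)
  rw [← mul_pow, ← sq_abs (v i), ← sq_abs (c * w i), abs_mul, abs_of_nonneg hc]
  exact pow_le_pow_left₀ (by positivity) (h i) 2

theorem euclNorm_mulVec_le_frobNorm {ι κ : Type*} [Fintype ι] [Fintype κ] (A : Matrix ι κ ℝ)
    (v : κ → ℝ) : euclNorm (A *ᵥ v) ≤ frobNorm A * euclNorm v := by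
  have hA : 0 ≤ ∑ i, ∑ j, A i j ^ 2 :=
    Finset.sum_nonneg fun i _ => Finset.sum_nonneg fun j _ => sq_nonneg _
  rw [euclNorm, frobNorm, euclNorm, ← Real.sqrt_mul hA, Finset.sum_mul]
  exact Real.sqrt_le_sqrt (Finset.sum_le_sum fun i _ => Finset.sum_mul_sq_le_sq_mul_sq _ _ _)

theorem euclNorm_mulVec_le_specNorm {ι κ : Type*} [Fintype ι] [Fintype κ] (A : Matrix ι κ ℝ)
    {v : κ → ℝ} (hv : euclNorm v = 1) : euclNorm (A *ᵥ v) ≤ specNorm A := by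
  refine le_csSup ⟨frobNorm A, ?_⟩ ⟨v, hv, rfl⟩
  rintro _ ⟨w, hw, rfl⟩
  simpa [hw] using euclNorm_mulVec_le_frobNorm A w

theorem euclNorm_mulVec_of_transpose_mul_self {ι κ : Type*} [Fintype ι] [Fintype κ]
    [DecidableEq κ] {V : Matrix ι κ ℝ} (hV : Vᵀ * V = 1) (v : κ → ℝ) :
    euclNorm (V *ᵥ v) = euclNorm v := by
  refine (sq_eq_sq₀ (euclNorm_nonneg _) (euclNorm_nonneg _)).1 ?_
  rw [euclNorm_sq, euclNorm_sq, dotProduct_mulVec, ← mulVec_transpose, mulVec_mulVec, hV,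
    one_mulVec]

theorem euclNorm_sq_eq_add_of_transpose_mul_self {ι κ : Type*} [Fintype ι] [Fintype κ]
    [DecidableEq ι] [DecidableEq κ] {V : Matrix ι κ ℝ} (hV : Vᵀ * V = 1) (w : ι → ℝ) :
    euclNorm w ^ 2 = euclNorm (Vᵀ *ᵥ w) ^ 2 + euclNorm ((1 - V * Vᵀ) *ᵥ w) ^ 2 := by
  have hcross : w ⬝ᵥ (V *ᵥ (Vᵀ *ᵥ w)) = (Vᵀ *ᵥ w) ⬝ᵥ (Vᵀ *ᵥ w) := by
    rw [dotProduct_mulVec, ← mulVec_transpose]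
  have hself : (V *ᵥ (Vᵀ *ᵥ w)) ⬝ᵥ (V *ᵥ (Vᵀ *ᵥ w)) = (Vᵀ *ᵥ w) ⬝ᵥ (Vᵀ *ᵥ w) := by
    rw [← euclNorm_sq, ← euclNorm_sq, euclNorm_mulVec_of_transpose_mul_self hV]
  rw [euclNorm_sq, euclNorm_sq, euclNorm_sq, sub_mulVec, one_mulVec, ← mulVec_mulVec,
    sub_dotProduct, dotProduct_sub, dotProduct_sub, dotProduct_comm (V *ᵥ (Vᵀ *ᵥ w)) w,
    hcross, hself]
  ring

theorem euclNorm_transpose_mulVec_le {ι κ : Type*} [Fintype ι] [Fintype κ]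
    [DecidableEq ι] [DecidableEq κ] {V : Matrix ι κ ℝ} (hV : Vᵀ * V = 1) (w : ι → ℝ) :
    euclNorm (Vᵀ *ᵥ w) ≤ euclNorm w := by
  refine (sq_le_sq₀ (euclNorm_nonneg _) (euclNorm_nonneg _)).1 ?_
  rw [euclNorm_sq_eq_add_of_transpose_mul_self hV w]
  exact le_add_of_nonneg_right (sq_nonneg _)

theorem sqrt_one_sub_matDist_sq_le {m k l : ℕ} {W : Matrix (Fin m) (Fin k) ℝ}
    {U : Matrix (Fin m) (Fin l) ℝ} (hW : Wᵀ * W = 1) (hU : Uᵀ * U = 1) {v : Fin l → ℝ}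
    (hv : euclNorm v = 1) :
    Real.sqrt (1 - matDist W U ^ 2) ≤ euclNorm (Wᵀ *ᵥ (U *ᵥ v)) := by
  have hUv : euclNorm (U *ᵥ v) = 1 := by rw [euclNorm_mulVec_of_transpose_mul_self hU, hv]
  have hdist : euclNorm ((1 - W * Wᵀ) *ᵥ (U *ᵥ v)) ≤ matDist W U := by
    have h : euclNorm (((1 - colProj W) * colProj U) *ᵥ (U *ᵥ v)) ≤ matDist W U :=
      euclNorm_mulVec_le_specNorm _ hUv
    have hfix : U * Uᵀ * U = U := by rw [Matrix.mul_assoc, hU, Matrix.mul_one]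
    have hPW : colProj W = W * Wᵀ := by simp [colProj, hW]
    have hPU : colProj U = U * Uᵀ := by simp [colProj, hU]
    rwa [← mulVec_mulVec, hPU, mulVec_mulVec v, hfix, hPW] at h
  refine Real.sqrt_le_iff.2 ⟨euclNorm_nonneg _, ?_⟩
  have hsplit := euclNorm_sq_eq_add_of_transpose_mul_self hW (U *ᵥ v)
  rw [hUv] at hsplit
  have := pow_le_pow_left₀ (euclNorm_nonneg _) hdist 2
  linarith

theorem le_minSingVal {ι : Type*} [Fintype ι] [Nonempty ι] {A : Matrix ι ι ℝ} {c : ℝ}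
    (h : ∀ v, euclNorm v = 1 → c ≤ euclNorm (A *ᵥ v)) : c ≤ minSingVal A := by
  classical
  refine le_csInf ⟨_, Pi.single (Classical.arbitrary ι) 1, ?_, rfl⟩ ?_
  · simp [euclNorm_eq_norm]
  · rintro _ ⟨v, hv, rfl⟩
    exact h v hv

/-- Lemma: lower bound on `σ_min(R^{(t+1)})` for the noisy sensing update
`V̂^{t+1} = V*Σ*(U*)ᵀU^t − F + V^NΣ^N(U^N)ᵀU^t − G = V^{t+1}R^{(t+1)}`:
`σ_min(R^{(t+1)}) ≥ σ*_k √(1 − dist(U^t,U*)²) − σ^N_1 − ‖F‖₂ − ‖G‖₂`. -/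
theorem R_bound_noisy_sensing
    (m n k r : ℕ) (hk : 0 < k) (hr : 0 < r)
    (M N : Matrix (Fin m) (Fin n) ℝ)
    (Ustar : Matrix (Fin m) (Fin k) ℝ) (Vstar : Matrix (Fin n) (Fin k) ℝ)
    (σ : Fin k → ℝ)
    (hUo : Ustarᵀ * Ustar = 1) (hVo : Vstarᵀ * Vstar = 1)
    (hM : M = Ustar * Matrix.diagonal σ * Vstarᵀ) (hrank : M.rank = k)
    (hσpos : ∀ i, 0 < σ i)
    (hσmono : ∀ i j : Fin k, i ≤ j → σ j ≤ σ i)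
    -- SVD of the noise matrix `N = U^N Σ^N (V^N)ᵀ`
    (UN : Matrix (Fin m) (Fin r) ℝ) (VN : Matrix (Fin n) (Fin r) ℝ) (sN : Fin r → ℝ)
    (hUNo : UNᵀ * UN = 1) (hVNo : VNᵀ * VN = 1)
    (hsN : ∀ q, 0 ≤ sN q)
    (hsNmono : ∀ p q : Fin r, p ≤ q → sN q ≤ sN p)
    (hN : N = UN * Matrix.diagonal sN * VNᵀ)
    -- current iterate with orthonormal columns
    (Ut : Matrix (Fin m) (Fin k) ℝ) (hUt : Utᵀ * Ut = 1)
    -- error matrices and update equation with QR decomposition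
    (F G : Matrix (Fin n) (Fin k) ℝ)
    (Vhat Vt : Matrix (Fin n) (Fin k) ℝ) (R : Matrix (Fin k) (Fin k) ℝ)
    (hupdate : Vhat =
      Vstar * Matrix.diagonal σ * Ustarᵀ * Ut - F + VN * Matrix.diagonal sN * UNᵀ * Ut - G)
    (hQR : Vhat = Vt * R) (hVt : Vtᵀ * Vt = 1)
    (hRtri : ∀ i j : Fin k, j < i → R i j = 0) :
    σ ⟨k - 1, Nat.sub_one_lt hk.ne'⟩ * Real.sqrt (1 - matDist Ustar Ut ^ 2) -
        sN ⟨0, hr⟩ - specNorm F - specNorm G ≤ minSingVal R := by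
  have : Nonempty (Fin k) := ⟨⟨0, hk⟩⟩
  refine le_minSingVal fun v hv => ?_
  set u := Ut *ᵥ v with hu
  have hu_norm : euclNorm u = 1 := by rw [hu, euclNorm_mulVec_of_transpose_mul_self hUt, hv]
  set c := σ ⟨k - 1, Nat.sub_one_lt hk.ne'⟩ with hc
  have hsignal : c * Real.sqrt (1 - matDist Ustar Ut ^ 2) ≤
      euclNorm (Vstar *ᵥ (diagonal σ *ᵥ (Ustarᵀ *ᵥ u))) := by
    rw [euclNorm_mulVec_of_transpose_mul_self hVo]
    refine (mul_le_mul_of_nonneg_left (sqrt_one_sub_matDist_sq_le hUo hUt hv)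
      (hσpos _).le).trans (mul_euclNorm_le_of_le_abs (hσpos _).le fun i => ?_)
    rw [mulVec_diagonal, abs_mul, abs_of_pos (hσpos i)]
    exact mul_le_mul_of_nonneg_right
      (hσmono _ _ (Fin.mk_le_mk.2 (Nat.le_sub_one_of_lt i.isLt))) (abs_nonneg _)
  have hnoise : euclNorm (VN *ᵥ (diagonal sN *ᵥ (UNᵀ *ᵥ u))) ≤ sN ⟨0, hr⟩ := by
    rw [euclNorm_mulVec_of_transpose_mul_self hVNo]
    refine (euclNorm_le_mul_of_abs_le (w := UNᵀ *ᵥ u) (hsN ⟨0, hr⟩) fun i => ?_).trans ?_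
    · rw [mulVec_diagonal, abs_mul, abs_of_nonneg (hsN i)]
      exact mul_le_mul_of_nonneg_right (hsNmono _ _ (Fin.mk_le_mk.2 (Nat.zero_le _)))
        (abs_nonneg _)
    · have hle := euclNorm_transpose_mulVec_le hUNo u
      rw [hu_norm] at hle
      exact mul_le_of_le_one_right (hsN _) hle
  have hF := euclNorm_mulVec_le_specNorm F hv
  have hG := euclNorm_mulVec_le_specNorm G hv
  have hR : euclNorm (R *ᵥ v) = euclNorm (Vhat *ᵥ v) := by
    rw [hQR, ← mulVec_mulVec, euclNorm_mulVec_of_transpose_mul_self hVt]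
  have hdecomp : Vstar *ᵥ (diagonal σ *ᵥ (Ustarᵀ *ᵥ u)) + VN *ᵥ (diagonal sN *ᵥ (UNᵀ *ᵥ u)) =
      Vhat *ᵥ v + (F *ᵥ v + G *ᵥ v) := by
    simp only [hupdate, hu, add_mulVec, sub_mulVec, mulVec_mulVec, Matrix.mul_assoc]
    abel
  have hsub : euclNorm (Vstar *ᵥ (diagonal σ *ᵥ (Ustarᵀ *ᵥ u))) ≤
      euclNorm (Vhat *ᵥ v + (F *ᵥ v + G *ᵥ v)) +
        euclNorm (VN *ᵥ (diagonal sN *ᵥ (UNᵀ *ᵥ u))) := by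
    rw [← hdecomp]
    simp only [euclNorm_eq_norm, WithLp.toLp_add]
    exact norm_le_add_norm_add _ _
  have h₁ := euclNorm_add_le (Vhat *ᵥ v) (F *ᵥ v + G *ᵥ v)
  have h₂ := euclNorm_add_le (F *ᵥ v) (G *ᵥ v)
  linarith

end AltMin
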